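/- arXiv:2605.00579 — 8 statements merged into one kernel-verified Lean document; each statement's English description precedes it below -/
import Mathlib

section
/- A support-feasible vector m maximizes Φ over all support-feasible vectors if and only if it satisfies the marginal-exchange condition: for every a ∈ S with m_a ≥ 2 and every b ∈ S, c_a·log(m_a/(m_a − 1)) ≥ c_b·log((m_b + 1)/m_b). -/
open Finset

theorem log_add_one_div_anti {x y : ℝ} (hx : 0 < x) (hxy : x ≤ y) :
    Real.log ((y + 1) / y) ≤ Real.log ((x + 1) / x) := by
  have hy : 0 < y := hx.trans_le hxy
  apply Real.log_le_log (by positivity)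
  rw [div_le_div_iff₀ hy hx]
  nlinarith

theorem log_add_nat_sub_log_le {x : ℝ} (hx : 0 < x) (k : ℕ) :
    Real.log (x + k) - Real.log x ≤ k * Real.log ((x + 1) / x) := by
  induction k with
  | zero => simp
  | succ k ih =>
    have hk : (0 : ℝ) ≤ k := k.cast_nonneg
    have h := log_add_one_div_anti hx (show x ≤ x + k by linarith)
    rw [Real.log_div (x := x + k + 1) (by positivity) (by positivity)] at h
    push_cast
    rw [← add_assoc]
    linarith

theorem mul_log_div_le_log_add_nat_sub_log {x : ℝ} (hx : 0 < x) (k : ℕ) :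
    k * Real.log ((x + k) / (x + k - 1)) ≤ Real.log (x + k) - Real.log x := by
  induction k with
  | zero => simp
  | succ k ih =>
    have hk : (0 : ℝ) ≤ k := k.cast_nonneg
    have h : (k : ℝ) * Real.log ((x + k + 1) / (x + k)) ≤
        k * Real.log ((x + k) / (x + k - 1)) := by
      rcases Nat.eq_zero_or_pos k with rfl | hpos
      · simp
      · have hk1 : (1 : ℝ) ≤ k := by exact_mod_cast hpos
        have h := log_add_one_div_anti (show 0 < x + k - 1 by linarith)
          (show x + k - 1 ≤ x + k by linarith)
        rw [sub_add_cancel] at h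
        gcongr
    have e := Real.log_div (x := x + k + 1) (y := x + k) (by positivity) (by positivity)
    push_cast
    rw [← add_assoc, add_sub_cancel_right]
    linarith

theorem stmt_2 {A : Type*} [Fintype A] [DecidableEq A]
    (c : A → ℕ) (M N r : ℕ) (S : Finset A)
    (hN : N = ∑ a, c a) (hNpos : 0 < N)
    (hS : S = univ.filter fun a => 0 < c a)
    (hr : r = S.card) (hM : r ≤ M) (hM1 : 1 ≤ M)
    (Feas : (A → ℕ) → Prop)
    (hFeas : ∀ m, Feas m ↔
      ((∀ a ∈ S, 1 ≤ m a) ∧ (∀ a ∉ S, m a = 0) ∧ ∑ a, m a = M))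
    (Φ : (A → ℕ) → ℝ)
    (hΦ : ∀ m, Φ m = ∑ a ∈ S, (c a : ℝ) * Real.log (m a))
    (m : A → ℕ) (hm : Feas m) :
    (∀ n, Feas n → Φ n ≤ Φ m) ↔
    (∀ a ∈ S, 2 ≤ m a → ∀ b ∈ S,
      (c b : ℝ) * Real.log (((m b : ℝ) + 1) / (m b : ℝ)) ≤
      (c a : ℝ) * Real.log ((m a : ℝ) / ((m a : ℝ) - 1))) := by
  have hΦ_sub (n : A → ℕ) : Φ n - Φ m =
      ∑ a ∈ S, ((c a : ℝ) * Real.log (n a) - c a * Real.log (m a)) := by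
    rw [hΦ, hΦ, sum_sub_distrib]
  obtain ⟨hm1, hm0, hmM⟩ := (hFeas m).1 hm
  have hpos (a) (ha : a ∈ S) : (1 : ℝ) ≤ m a := by exact_mod_cast hm1 a ha
  constructor
  · intro hmax a ha ha2 b hb
    have ha2' : (2 : ℝ) ≤ m a := by exact_mod_cast ha2
    have hb1 := hpos b hb
    rcases eq_or_ne a b with rfl | hab
    · have h := log_add_one_div_anti (show (0 : ℝ) < m a - 1 by linarith)
        (show (m a : ℝ) - 1 ≤ m a by linarith)
      rw [sub_add_cancel] at h
      gcongr
    · let n := Function.update (Function.update m a (m a - 1)) b (m b + 1)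
      have hna : n a = m a - 1 := by simp [n, hab]
      have hnb : n b = m b + 1 := by simp [n]
      have hne (x) (hxa : x ≠ a) (hxb : x ≠ b) : n x = m x := by simp [n, hxa, hxb]
      have hsplit (f : A → ℤ) (hf : ∀ x, x ≠ a ∧ x ≠ b → f x = 0) :
          ∑ x, f x = f a + f b := Fintype.sum_eq_add a b hab hf
      have hn : Feas n := by
        refine (hFeas n).2 ⟨fun x hx => ?_, fun x hx => ?_, ?_⟩
        · rcases eq_or_ne x b with rfl | hxb
          · omega
          rcases eq_or_ne x a with rfl | hxa
          · omega
          rw [hne x hxa hxb]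
          exact hm1 x hx
        · rw [hne x (by rintro rfl; exact hx ha) (by rintro rfl; exact hx hb)]
          exact hm0 x hx
        · have h := hsplit (fun x => (n x : ℤ) - m x)
            (fun x hx => by simp [hne x hx.1 hx.2])
          rw [sum_sub_distrib] at h
          have hz : (∑ x, (n x : ℤ)) = ∑ x, (m x : ℤ) := by omega
          rw [← hmM]
          exact_mod_cast hz
      have h := hΦ_sub n
      rw [sum_eq_add_of_mem a b ha hb hab
        (fun x _ hx => by rw [hne x hx.1 hx.2, sub_self]), hna, hnb] at h
      rw [Real.log_div (by positivity) (by positivity),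
        Real.log_div (by positivity) (by linarith)]
      have hle := hmax n hn
      push_cast [Nat.cast_sub (show 1 ≤ m a by omega)] at h
      linarith
  · intro hex n hn
    obtain ⟨hn1, hn0, hnM⟩ := (hFeas n).1 hn
    have hne : S.Nonempty := by
      obtain ⟨a, -, ha⟩ := exists_ne_zero_of_sum_ne_zero (hN ▸ hNpos.ne')
      exact ⟨a, by simp [hS, Nat.pos_of_ne_zero ha]⟩
    obtain ⟨b, hb, hbmax⟩ := S.exists_max_image
      (fun b => (c b : ℝ) * Real.log (((m b : ℝ) + 1) / m b)) hne
    set μ := (c b : ℝ) * Real.log (((m b : ℝ) + 1) / m b)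
    have hsum (k : A → ℕ) (hk : ∀ a ∉ S, k a = 0) (hkM : ∑ a, k a = M) :
        ∑ a ∈ S, (k a : ℝ) = M := by
      rw [← hkM, Nat.cast_sum]
      exact sum_subset (subset_univ S) fun a _ ha => by simp [hk a ha]
    have hterm : ∀ a ∈ S, (c a : ℝ) * Real.log (n a) - c a * Real.log (m a) ≤
        μ * ((n a : ℝ) - m a) := by
      intro a ha
      have hca : (0 : ℝ) ≤ c a := Nat.cast_nonneg _
      have hma := hpos a ha
      have hna : (1 : ℝ) ≤ n a := by exact_mod_cast hn1 a ha
      rcases le_or_gt (m a) (n a) with hle | hlt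
      · obtain ⟨k, hk⟩ := Nat.exists_eq_add_of_le hle
        have h := mul_le_mul_of_nonneg_left
          (log_add_nat_sub_log_le (x := m a) (by linarith) k) hca
        have h' := mul_le_mul_of_nonneg_left (hbmax a ha) k.cast_nonneg (α := ℝ)
        rw [hk]
        push_cast
        linarith
      · obtain ⟨k, hk⟩ := Nat.exists_eq_add_of_le hlt.le
        have h := mul_le_mul_of_nonneg_left
          (mul_log_div_le_log_add_nat_sub_log (x := n a) (by linarith) k) hca
        have h' := mul_le_mul_of_nonneg_left
          (hex a ha (by have := hn1 a ha; omega) b hb) k.cast_nonneg (α := ℝ)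
        change (k : ℝ) * μ ≤ _ at h'
        rw [hk] at h' ⊢
        push_cast at h' ⊢
        linarith
    have h := sum_le_sum hterm
    rw [← hΦ_sub, ← mul_sum, sum_sub_distrib, hsum n hn0 hnM, hsum m hm0 hmM] at h
    linarith
end

section
/- Let m* be any support-feasible vector maximizing Φ over all support-feasible vectors. Then for every a ∈ S, s_a − p_a·(r − 2) − 1 ≤ m*_a ≤ s_a + p_a·(r − 2) + 1, where p_a = c_a/N and s_a = M·c_a/N. -/
open Finset

theorem Finset.sum_sub_sum_eq_of_eq_off_pair {A G : Type*} [DecidableEq A] [AddCommGroup G]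
    {S : Finset A} {a b : A} (ha : a ∈ S) (hb : b ∈ S) (hab : a ≠ b) {f g : A → G}
    (h : ∀ x, x ≠ a → x ≠ b → f x = g x) :
    ∑ x ∈ S, f x - ∑ x ∈ S, g x = (f a - g a) + (f b - g b) := by
  rw [← Finset.sum_sub_distrib, ← Finset.sum_pair hab (f := fun x => f x - g x)]
  symm
  apply Finset.sum_subset
  · intro x hx
    simp only [Finset.mem_insert, Finset.mem_singleton] at hx
    rcases hx with rfl | rfl <;> assumption
  · intro x _ hx
    simp only [Finset.mem_insert, Finset.mem_singleton, not_or] at hx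
    exact sub_eq_zero.mpr (h x hx.1 hx.2)

theorem Real.one_div_add_one_le_log_add_one_sub_log {x : ℝ} (hx : 0 < x) :
    1 / (x + 1) ≤ Real.log (x + 1) - Real.log x := by
  have h := Real.log_le_sub_one_of_pos (x := x / (x + 1)) (by positivity)
  rw [Real.log_div (by positivity) (by positivity)] at h
  have : x / (x + 1) - 1 = -(1 / (x + 1)) := by field_simp; ring
  linarith

theorem Real.log_add_one_sub_log_le_one_div {x : ℝ} (hx : 0 < x) :
    Real.log (x + 1) - Real.log x ≤ 1 / x := by
  have h := Real.log_le_sub_one_of_pos (x := (x + 1) / x) (by positivity)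
  rw [Real.log_div (by positivity) (by positivity)] at h
  have : (x + 1) / x - 1 = 1 / x := by field_simp; ring
  linarith

/-- Moving one unit from `b` to `a` cannot increase the objective at a maximizer. -/
theorem mul_sub_one_le_of_isMax_sum_mul_log {A : Type*} [Fintype A] [DecidableEq A]
    {c m : A → ℕ} {S : Finset A} (hm : ∀ x ∈ S, 1 ≤ m x)
    (hmax : ∀ n : A → ℕ, (∀ x ∈ S, 1 ≤ n x) → (∀ x ∉ S, n x = m x) → ∑ x, n x = ∑ x, m x →
      ∑ x ∈ S, (c x : ℝ) * Real.log (n x) ≤ ∑ x ∈ S, (c x : ℝ) * Real.log (m x))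
    {a b : A} (ha : a ∈ S) (hb : b ∈ S) (hab : a ≠ b) :
    (c a : ℝ) * ((m b : ℝ) - 1) ≤ c b * ((m a : ℝ) + 1) := by
  obtain ⟨k, hk⟩ : ∃ k, m b = k + 1 := ⟨m b - 1, by have := hm b hb; omega⟩
  have hma : (0 : ℝ) < m a := by exact_mod_cast hm a ha
  rcases Nat.eq_zero_or_pos k with rfl | hkpos
  · have : (m b : ℝ) = 1 := by simp [hk]
    rw [this, sub_self, mul_zero]
    positivity
  have hkR : (0 : ℝ) < k := by exact_mod_cast hkpos
  let n : A → ℕ := fun x => if x = a then m a + 1 else if x = b then k else m x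
  have hna : n a = m a + 1 := by simp [n]
  have hnb : n b = k := by simp [n, hab.symm]
  have hne : ∀ x, x ≠ a → x ≠ b → n x = m x := fun x hxa hxb => by simp [n, hxa, hxb]
  have hle := hmax n
    (fun x hx => by
      by_cases hxa : x = a
      · subst hxa; omega
      by_cases hxb : x = b
      · subst hxb; omega
      rw [hne x hxa hxb]; exact hm x hx)
    (fun x hx => hne x (fun h => hx (h ▸ ha)) (fun h => hx (h ▸ hb)))
    (by
      have h := Finset.sum_sub_sum_eq_of_eq_off_pair (mem_univ a) (mem_univ b) hab
        (f := fun x => (n x : ℤ)) (g := fun x => (m x : ℤ))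
        (fun x hxa hxb => by simp only [hne x hxa hxb])
      simp only [hna, hnb, hk] at h
      push_cast at h
      zify
      linarith)
  have hdiff := Finset.sum_sub_sum_eq_of_eq_off_pair ha hb hab
    (f := fun x => (c x : ℝ) * Real.log (n x)) (g := fun x => (c x : ℝ) * Real.log (m x))
    (fun x hxa hxb => by simp only [hne x hxa hxb])
  simp only [hna, hnb, hk] at hdiff
  push_cast at hdiff
  have h1 := mul_le_mul_of_nonneg_left (Real.one_div_add_one_le_log_add_one_sub_log hma)
    (Nat.cast_nonneg (α := ℝ) (c a))
  have h2 := mul_le_mul_of_nonneg_left (Real.log_add_one_sub_log_le_one_div hkR)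
    (Nat.cast_nonneg (α := ℝ) (c b))
  have h3 : (c a : ℝ) / (m a + 1) ≤ c b / k := by
    rw [div_eq_mul_one_div, div_eq_mul_one_div (c b : ℝ)]
    linarith
  rw [div_le_div_iff₀ (by positivity) hkR] at h3
  simpa [hk] using h3

theorem stmt_5 {A : Type*} [Fintype A] [DecidableEq A]
    (c : A → ℕ) (M N r : ℕ) (S : Finset A)
    (hN : N = ∑ a, c a) (hNpos : 0 < N)
    (hS : S = univ.filter fun a => 0 < c a)
    (hr : r = S.card) (hM : r ≤ M) (hM1 : 1 ≤ M)
    (Feas : (A → ℕ) → Prop)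
    (hFeas : ∀ m, Feas m ↔
      ((∀ a ∈ S, 1 ≤ m a) ∧ (∀ a ∉ S, m a = 0) ∧ ∑ a, m a = M))
    (Φ : (A → ℕ) → ℝ)
    (hΦ : ∀ m, Φ m = ∑ a ∈ S, (c a : ℝ) * Real.log (m a))
    (mstar : A → ℕ) (hmstar : Feas mstar)
    (hmax : ∀ n, Feas n → Φ n ≤ Φ mstar) :
    ∀ a ∈ S,
      (M : ℝ) * (c a : ℝ) / N - (c a : ℝ) / N * ((r : ℝ) - 2) - 1 ≤ (mstar a : ℝ) ∧
      (mstar a : ℝ) ≤ (M : ℝ) * (c a : ℝ) / N + (c a : ℝ) / N * ((r : ℝ) - 2) + 1 := by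
  intro a ha
  obtain ⟨hpos, hzero, hsum⟩ := (hFeas mstar).mp hmstar
  have hexch : ∀ x ∈ S, ∀ y ∈ S, x ≠ y →
      (c x : ℝ) * ((mstar y : ℝ) - 1) ≤ c y * ((mstar x : ℝ) + 1) := by
    intro x hx y hy hxy
    refine mul_sub_one_le_of_isMax_sum_mul_log hpos (fun n h1 h2 h3 => ?_) hx hy hxy
    rw [← hΦ, ← hΦ]
    exact hmax n ((hFeas n).mpr
      ⟨h1, fun x hx => (h2 x hx).trans (hzero x hx), h3.trans hsum⟩)
  have hNS : ∑ x ∈ S, (c x : ℝ) = N := by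
    rw [hN, Nat.cast_sum]
    refine Finset.sum_subset (subset_univ S) fun x _ hx => ?_
    simpa [hS] using hx
  have hMS : ∑ x ∈ S, (mstar x : ℝ) = M := by
    rw [← hsum, Nat.cast_sum]
    exact Finset.sum_subset (subset_univ S) fun x _ hx => by simp [hzero x hx]
  have hrS : ∑ _x ∈ S, (1 : ℝ) = r := by simp [hr]
  rw [← Finset.add_sum_erase S _ ha] at hNS hMS hrS
  have hlow := Finset.sum_le_sum fun y (hy : y ∈ S.erase a) =>
    hexch a ha y (mem_of_mem_erase hy) (ne_of_mem_erase hy).symm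
  have hupp := Finset.sum_le_sum fun y (hy : y ∈ S.erase a) =>
    hexch y (mem_of_mem_erase hy) a ha (ne_of_mem_erase hy)
  rw [← Finset.mul_sum, ← Finset.sum_mul, Finset.sum_sub_distrib, eq_sub_of_add_eq' hNS,
    eq_sub_of_add_eq' hMS, eq_sub_of_add_eq' hrS] at hlow
  rw [← Finset.mul_sum, ← Finset.sum_mul, Finset.sum_add_distrib, eq_sub_of_add_eq' hNS,
    eq_sub_of_add_eq' hMS, eq_sub_of_add_eq' hrS] at hupp
  have hNR : (0 : ℝ) < N := by exact_mod_cast hNpos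
  constructor
  · have h : (M : ℝ) * c a / N - c a / N * ((r : ℝ) - 2) - 1
        = (M * c a - c a * ((r : ℝ) - 2) - N) / N := by field_simp
    rw [h, div_le_iff₀ hNR]
    linarith
  · have h : (M : ℝ) * c a / N + c a / N * ((r : ℝ) - 2) + 1
        = (M * c a + c a * ((r : ℝ) - 2) + N) / N := by field_simp
    rw [h, le_div_iff₀ hNR]
    linarith
end

section
/- Suppose r ≥ 2, m is support-feasible, a ∈ S, and m_a > p_a·(M + r − 2) + 1 where p_a = c_a/N. Then there exists b ∈ S with b ≠ a such that c_b/(m_b + 1) > c_a/(m_a − 1). -/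
open Finset

theorem stmt_6 {A : Type*} [Fintype A] [DecidableEq A]
    (c : A → ℕ) (M N r : ℕ) (S : Finset A)
    (hN : N = ∑ a, c a) (hNpos : 0 < N)
    (hS : S = univ.filter fun a => 0 < c a)
    (hr : r = S.card) (hM : r ≤ M) (hM1 : 1 ≤ M)
    (hr2 : 2 ≤ r)
    (Feas : (A → ℕ) → Prop)
    (hFeas : ∀ m, Feas m ↔
      ((∀ a ∈ S, 1 ≤ m a) ∧ (∀ a ∉ S, m a = 0) ∧ ∑ a, m a = M))
    (m : A → ℕ) (hm : Feas m)
    (a : A) (ha : a ∈ S)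
    (hbig : ((c a : ℝ) / N) * ((M : ℝ) + (r : ℝ) - 2) + 1 < (m a : ℝ)) :
    ∃ b ∈ S, b ≠ a ∧ (c a : ℝ) / ((m a : ℝ) - 1) < (c b : ℝ) / ((m b : ℝ) + 1) := by
  obtain ⟨-, hm0, hmM⟩ := (hFeas m).1 hm
  have hc0 : ∀ b ∉ S, c b = 0 := by
    intro b hb
    simpa [hS] using hb
  have hcS : ∑ b ∈ S, (c b : ℝ) = N := by
    rw [hN, ← Finset.sum_subset (Finset.subset_univ S) fun b _ hb => hc0 b hb]
    push_cast
    rfl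
  have hmS : ∑ b ∈ S, (m b : ℝ) = M := by
    rw [← hmM, ← Finset.sum_subset (Finset.subset_univ S) fun b _ hb => hm0 b hb]
    push_cast
    rfl
  have hNr : (0 : ℝ) < N := by exact_mod_cast hNpos
  have hr2' : (2 : ℝ) ≤ r := by exact_mod_cast hr2
  have hMr : (0 : ℝ) ≤ (M : ℝ) + r - 2 := by
    have : (0 : ℝ) ≤ M := Nat.cast_nonneg M
    linarith
  have hma : (0 : ℝ) < (m a : ℝ) - 1 := by
    have : 0 ≤ ((c a : ℝ) / N) * ((M : ℝ) + r - 2) := by positivity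
    linarith
  by_contra! h
  have hsum : ∑ b ∈ S.erase a, (c b : ℝ) * ((m a : ℝ) - 1)
      ≤ ∑ b ∈ S.erase a, (c a : ℝ) * ((m b : ℝ) + 1) := by
    refine Finset.sum_le_sum fun b hb => ?_
    have hb' := h b (Finset.mem_of_mem_erase hb) (Finset.ne_of_mem_erase hb)
    rwa [div_le_div_iff₀ (by positivity) hma] at hb'
  rw [← Finset.sum_mul, ← Finset.mul_sum, Finset.sum_add_distrib] at hsum
  have hce := Finset.add_sum_erase S (fun b => (c b : ℝ)) ha
  have hme := Finset.add_sum_erase S (fun b => (m b : ℝ)) ha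
  have h1e := Finset.add_sum_erase S (fun _ => (1 : ℝ)) ha
  have h1S : ∑ _b ∈ S, (1 : ℝ) = r := by simp [hr]
  rw [eq_sub_of_add_eq' hce, eq_sub_of_add_eq' hme, eq_sub_of_add_eq' h1e,
    hcS, hmS, h1S] at hsum
  have hlt : (c a : ℝ) * ((M : ℝ) + r - 2) < ((m a : ℝ) - 1) * N := by
    rw [← div_lt_iff₀ hNr, mul_div_right_comm]
    linarith
  linarith
end

section
/- Suppose r ≥ 2, m is support-feasible, a ∈ S, and m_a < p_a·(M − r + 2) − 1 where p_a = c_a/N. Then there exists b ∈ S with b ≠ a such that m_b ≥ 2 and c_b/(m_b − 1) < c_a/(m_a + 1). -/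
open Finset

theorem stmt_7 {A : Type*} [Fintype A] [DecidableEq A]
    (c : A → ℕ) (M N r : ℕ) (S : Finset A)
    (hN : N = ∑ a, c a) (hNpos : 0 < N)
    (hS : S = univ.filter fun a => 0 < c a)
    (hr : r = S.card) (hM : r ≤ M) (hM1 : 1 ≤ M)
    (hr2 : 2 ≤ r)
    (Feas : (A → ℕ) → Prop)
    (hFeas : ∀ m, Feas m ↔
      ((∀ a ∈ S, 1 ≤ m a) ∧ (∀ a ∉ S, m a = 0) ∧ ∑ a, m a = M))
    (m : A → ℕ) (hm : Feas m)
    (a : A) (ha : a ∈ S)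
    (hsmall : (m a : ℝ) < ((c a : ℝ) / N) * ((M : ℝ) - (r : ℝ) + 2) - 1) :
    ∃ b ∈ S, b ≠ a ∧ 2 ≤ m b ∧
      (c b : ℝ) / ((m b : ℝ) - 1) < (c a : ℝ) / ((m a : ℝ) + 1) := by
  by_contra! hcon
  obtain ⟨hpos, hzero, hsum⟩ := (hFeas m).1 hm
  have hNR : (0 : ℝ) < N := by exact_mod_cast hNpos
  have hterm : ∀ b ∈ S, (c a : ℝ) * ((m b : ℝ) - 1) + (if b = a then 2 * (c a : ℝ) else 0)
      ≤ (c b : ℝ) * ((m a : ℝ) + 1) := by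
    intro b hb
    rcases eq_or_ne b a with rfl | hba
    · rw [if_pos rfl]
      linarith
    rw [if_neg hba, add_zero]
    rcases (hpos b hb).eq_or_lt with h1 | h2
    · rw [← h1, Nat.cast_one, sub_self, mul_zero]
      positivity
    · have hmb : (0 : ℝ) < (m b : ℝ) - 1 := sub_pos.2 (by exact_mod_cast h2)
      exact (div_le_div_iff₀ (by positivity) hmb).1 (hcon b hb hba h2)
  have hsum_le := Finset.sum_le_sum hterm
  have hmS : ∑ b ∈ S, (m b : ℝ) = M := by
    rw [← hsum, Nat.cast_sum]
    exact Finset.sum_subset (subset_univ S) fun b _ hb => by rw [hzero b hb, Nat.cast_zero]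
  have hcS : ∑ b ∈ S, (c b : ℝ) = N := by
    rw [hN, Nat.cast_sum]
    refine Finset.sum_subset (subset_univ S) fun b _ hb => ?_
    simpa [hS] using hb
  rw [Finset.sum_add_distrib, ← Finset.mul_sum, ← Finset.sum_mul, Finset.sum_sub_distrib, hmS,
    hcS, Finset.sum_ite_eq' S a, if_pos ha, Finset.sum_const, nsmul_one, ← hr] at hsum_le
  rw [lt_sub_iff_add_lt, div_mul_eq_mul_div, lt_div_iff₀ hNR] at hsmall
  linarith
end

section
/- With L_a = max{1, ⌈s_a − p_a·(r − 2) − 1⌉} and U_a = ⌊s_a + p_a·(r − 2) + 1⌋ for a ∈ S, the box {m : L_a ≤ m_a ≤ U_a for all a ∈ S} contains a support-feasible maximizer of Φ, and consequently ∑_{a∈S} L_a ≤ M ≤ ∑_{a∈S} U_a. -/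
open Finset

/-- Moving one unit from `y + 1` to `x` strictly increases the weighted sum of logarithms
whenever `d * (x + 1) < c * y`. -/
theorem weighted_log_exchange {c d x y : ℝ} (hc : 0 ≤ c) (hd : 0 ≤ d) (hx : 0 < x) (hy : 0 < y)
    (h : d * (x + 1) < c * y) :
    0 < c * (Real.log (x + 1) - Real.log x) + d * (Real.log y - Real.log (y + 1)) := by
  have hx1 : 0 < x + 1 := by linarith
  have hy1 : 0 < y + 1 := by linarith
  have h1 : 1 / (x + 1) ≤ Real.log (x + 1) - Real.log x := by
    have := Real.one_sub_inv_le_log_of_pos (div_pos hx1 hx)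
    rw [Real.log_div hx1.ne' hx.ne'] at this
    refine le_trans (le_of_eq ?_) this
    field_simp
    ring
  have h2 : Real.log (y + 1) - Real.log y ≤ 1 / y := by
    have := Real.log_le_sub_one_of_pos (div_pos hy1 hy)
    rw [Real.log_div hy1.ne' hy.ne'] at this
    refine le_trans this (le_of_eq ?_)
    field_simp
    ring
  have h3 : d * (1 / y) < c * (1 / (x + 1)) := by
    rw [mul_one_div, mul_one_div, div_lt_div_iff₀ hy hx1]
    exact h
  have h4 := mul_le_mul_of_nonneg_left h1 hc
  have h5 := mul_le_mul_of_nonneg_left h2 hd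
  linarith

/-- A maximizer of the weighted sum of logarithms over positive allocations of `M` units
satisfies the pairwise exchange inequalities. -/
theorem exchange_le_of_maximal {A : Type*} [Fintype A] [DecidableEq A]
    {c : A → ℕ} {M : ℕ} {S : Finset A} {m : A → ℕ}
    (hpos : ∀ a ∈ S, 1 ≤ m a) (hzero : ∀ a ∉ S, m a = 0) (hsum : ∑ a, m a = M)
    (hmax : ∀ n : A → ℕ, (∀ a ∈ S, 1 ≤ n a) → (∀ a ∉ S, n a = 0) → ∑ a, n a = M →
      ∑ a ∈ S, (c a : ℝ) * Real.log (n a) ≤ ∑ a ∈ S, (c a : ℝ) * Real.log (m a))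
    {a b : A} (ha : a ∈ S) (hb : b ∈ S) (hab : a ≠ b) :
    (c a : ℝ) * ((m b : ℝ) - 1) ≤ c b * ((m a : ℝ) + 1) := by
  by_contra! hlt
  have hma := hpos a ha
  have hmb := hpos b hb
  have hmb2 : 2 ≤ m b := by
    by_contra! hlt2
    have h1 : m b = 1 := by omega
    rw [h1] at hlt
    have : (0 : ℝ) ≤ c b * ((m a : ℝ) + 1) := by positivity
    norm_num at hlt
    linarith
  obtain ⟨k, hk⟩ : ∃ k, m b = k + 1 := ⟨m b - 1, by omega⟩
  let n : A → ℕ := Function.update (Function.update m a (m a + 1)) b k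
  have hnb : n b = k := by simp [n]
  have hna : n a = m a + 1 := by simp [n, hab]
  have hn : ∀ x, x ≠ a → x ≠ b → n x = m x := fun x h1 h2 => by simp [n, h1, h2]
  have hle := hmax n ?_ ?_ ?_
  · have heq : ∑ x ∈ S, ((c x : ℝ) * Real.log (n x) - (c x : ℝ) * Real.log (m x)) =
        ((c a : ℝ) * Real.log (n a) - (c a : ℝ) * Real.log (m a)) +
        ((c b : ℝ) * Real.log (n b) - (c b : ℝ) * Real.log (m b)) :=
      sum_eq_add_of_mem a b ha hb hab fun x _ hx => by rw [hn x hx.1 hx.2, sub_self]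
    rw [sum_sub_distrib, hna, hnb, hk] at heq
    rw [hk] at hlt
    push_cast at heq hlt
    have := weighted_log_exchange (c := c a) (d := c b) (x := m a) (y := k) (by positivity)
      (by positivity) (by exact_mod_cast hma) (by exact_mod_cast (by omega : 0 < k))
      (by linarith)
    linarith
  · intro x hx
    by_cases h1 : x = a
    · subst h1; omega
    by_cases h2 : x = b
    · subst h2; omega
    rw [hn x h1 h2]
    exact hpos x hx
  · intro x hx
    rw [hn x (fun h => hx (h ▸ ha)) (fun h => hx (h ▸ hb))]
    exact hzero x hx
  · have heq : ∑ x, ((n x : ℤ) - m x) = ((n a : ℤ) - m a) + ((n b : ℤ) - m b) :=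
      sum_eq_add_of_mem a b (mem_univ a) (mem_univ b) hab fun x _ hx => by
        rw [hn x hx.1 hx.2, sub_self]
    rw [sum_sub_distrib, hna, hnb, hk] at heq
    have hsum' : ∑ x, (m x : ℤ) = M := by exact_mod_cast hsum
    have : ∑ x, (n x : ℤ) = M := by push_cast at heq; linarith
    exact_mod_cast this

/-- There is a maximizer of any objective over the positive allocations of `M` units to a nonempty
set `S` of at most `M` elements. -/
theorem exists_maximal_allocation {A : Type*} [Fintype A] [DecidableEq A]
    {M : ℕ} {S : Finset A} (hS : S.Nonempty) (hM : S.card ≤ M) (f : (A → ℕ) → ℝ) :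
    ∃ m : A → ℕ, ((∀ a ∈ S, 1 ≤ m a) ∧ (∀ a ∉ S, m a = 0) ∧ ∑ a, m a = M) ∧
      ∀ n : A → ℕ, ((∀ a ∈ S, 1 ≤ n a) ∧ (∀ a ∉ S, n a = 0) ∧ ∑ a, n a = M) → f n ≤ f m := by
  obtain ⟨a₀, ha₀⟩ := hS
  refine Set.exists_max_image
    {m : A → ℕ | (∀ a ∈ S, 1 ≤ m a) ∧ (∀ a ∉ S, m a = 0) ∧ ∑ a, m a = M} f ?_ ?_
  · refine (Set.finite_Iic (fun _ : A => M)).subset ?_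
    rintro m ⟨-, -, h⟩ a
    exact h ▸ single_le_sum (fun _ _ => Nat.zero_le _) (mem_univ a)
  · refine ⟨fun a => (if a ∈ S then 1 else 0) + (if a = a₀ then M - S.card else 0), ?_, ?_, ?_⟩
    · intro a ha
      simp [ha]
    · intro a ha
      have : a ≠ a₀ := fun h => ha (h ▸ ha₀)
      simp [ha, this]
    · simp only [sum_add_distrib, sum_ite_mem, sum_ite_eq', univ_inter, sum_const, mem_univ,
        if_true, smul_eq_mul, mul_one]
      omega

theorem stmt_11 {A : Type*} [Fintype A] [DecidableEq A]
    (c : A → ℕ) (M N r : ℕ) (S : Finset A)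
    (hN : N = ∑ a, c a) (hNpos : 0 < N)
    (hS : S = univ.filter fun a => 0 < c a)
    (hr : r = S.card) (hM : r ≤ M) (hM1 : 1 ≤ M)
    (Feas : (A → ℕ) → Prop)
    (hFeas : ∀ m, Feas m ↔
      ((∀ a ∈ S, 1 ≤ m a) ∧ (∀ a ∉ S, m a = 0) ∧ ∑ a, m a = M))
    (Φ : (A → ℕ) → ℝ)
    (hΦ : ∀ m, Φ m = ∑ a ∈ S, (c a : ℝ) * Real.log (m a))
    (L U : A → ℤ)
    (hL : ∀ a ∈ S, L a =
      max 1 ⌈(M : ℝ) * (c a : ℝ) / N - (c a : ℝ) / N * ((r : ℝ) - 2) - 1⌉)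
    (hU : ∀ a ∈ S, U a =
      ⌊(M : ℝ) * (c a : ℝ) / N + (c a : ℝ) / N * ((r : ℝ) - 2) + 1⌋) :
    (∃ m, Feas m ∧ (∀ n, Feas n → Φ n ≤ Φ m) ∧
      ∀ a ∈ S, L a ≤ (m a : ℤ) ∧ (m a : ℤ) ≤ U a) ∧
    (∑ a ∈ S, L a ≤ (M : ℤ) ∧ (M : ℤ) ≤ ∑ a ∈ S, U a) := by
  have hne : S.Nonempty := by
    by_contra h
    rw [not_nonempty_iff_eq_empty] at h
    have : ∀ a ∈ univ, c a = 0 := fun a _ => by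
      by_contra hca
      have : a ∈ S := by simp [hS, Nat.pos_of_ne_zero hca]
      simp [h] at this
    rw [sum_eq_zero this] at hN
    omega
  obtain ⟨m, ⟨hpos, hzero, hsum⟩, hmax⟩ := exists_maximal_allocation hne (hr ▸ hM) Φ
  have hsumS : ∑ a ∈ S, (m a : ℝ) = M := by
    rw [← hsum]
    push_cast
    exact sum_subset (subset_univ S) fun a _ ha => by simp [hzero a ha]
  have hsumc : ∑ a ∈ S, (c a : ℝ) = N := by
    rw [hN]
    push_cast
    refine sum_subset (subset_univ S) fun a _ ha => ?_
    have : c a = 0 := by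
      by_contra hca
      exact ha (by simp [hS, Nat.pos_of_ne_zero hca])
    simp [this]
  have hcard : (S.card : ℝ) = r := by rw [hr]
  have hex : ∀ a ∈ S, ∀ b ∈ S, a ≠ b →
      (c a : ℝ) * ((m b : ℝ) - 1) ≤ c b * ((m a : ℝ) + 1) := fun a ha b hb hab =>
    exchange_le_of_maximal hpos hzero hsum
      (fun n h1 h2 h3 => by rw [← hΦ, ← hΦ]; exact hmax n ⟨h1, h2, h3⟩) ha hb hab
  have hNR : (0 : ℝ) < N := by exact_mod_cast hNpos
  have hbox : ∀ a ∈ S, L a ≤ (m a : ℤ) ∧ (m a : ℤ) ≤ U a := by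
    intro a ha
    have hce : ∑ b ∈ S.erase a, (c b : ℝ) = N - c a := by
      rw [sum_erase_eq_sub ha, hsumc]
    have hme : ∑ b ∈ S.erase a, (m b : ℝ) = M - m a := by
      rw [sum_erase_eq_sub ha, hsumS]
    have hcarde : ((S.erase a).card : ℝ) = r - 1 := by
      rw [← hcard, ← card_erase_add_one ha]
      push_cast
      ring
    constructor
    · rw [hL a ha, max_le_iff]
      refine ⟨by exact_mod_cast hpos a ha, Int.ceil_le.2 ?_⟩
      have h : ∑ b ∈ S.erase a, (c a : ℝ) * ((m b : ℝ) - 1) ≤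
          ∑ b ∈ S.erase a, (c b : ℝ) * ((m a : ℝ) + 1) := sum_le_sum fun b hb =>
        hex a ha b (mem_of_mem_erase hb) (ne_of_mem_erase hb).symm
      rw [← mul_sum, ← sum_mul, sum_sub_distrib, hce, hme, sum_const, nsmul_eq_mul, hcarde] at h
      have : (M : ℝ) * c a / N - c a / N * ((r : ℝ) - 2) - 1 =
          (c a * (M - (r - 2)) - N) / N := by
        field_simp
      rw [this, div_le_iff₀ hNR]
      push_cast
      linarith
    · rw [hU a ha]
      refine Int.le_floor.2 ?_
      have h : ∑ b ∈ S.erase a, (c b : ℝ) * ((m a : ℝ) - 1) ≤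
          ∑ b ∈ S.erase a, (c a : ℝ) * ((m b : ℝ) + 1) := sum_le_sum fun b hb =>
        hex b (mem_of_mem_erase hb) a ha (ne_of_mem_erase hb)
      rw [← mul_sum, ← sum_mul, sum_add_distrib, hce, hme, sum_const, nsmul_eq_mul, hcarde] at h
      have : (M : ℝ) * c a / N + c a / N * ((r : ℝ) - 2) + 1 =
          (c a * (M + (r - 2)) + N) / N := by
        field_simp
      rw [this, le_div_iff₀ hNR]
      push_cast
      linarith
  have hsumZ : ∑ a ∈ S, (m a : ℤ) = M := by exact_mod_cast hsumS
  refine ⟨⟨m, (hFeas m).2 ⟨hpos, hzero, hsum⟩, fun n hn => hmax n ((hFeas n).1 hn), hbox⟩, ?_, ?_⟩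
  · exact hsumZ ▸ sum_le_sum fun a ha => (hbox a ha).1
  · exact hsumZ ▸ sum_le_sum fun a ha => (hbox a ha).2
end

section
/- With L_a = max{1, ⌈s_a − p_a·(r − 2) − 1⌉} and U_a = ⌊s_a + p_a·(r − 2) + 1⌋ for a ∈ S, call m box-feasible if m is support-feasible and L_a ≤ m_a ≤ U_a for all a ∈ S. Then every vector m̂ maximizing Φ over the box-feasible vectors also maximizes Φ over all support-feasible vectors; i.e., the optimum of the windowed problem is a global KL optimum. -/
open Finset

/-- Two families that agree away from two distinct indices `a`, `b` have sums that differ only by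
the contributions of `a` and `b`. -/
lemma sum_add_pair_comm {A β : Type*} [DecidableEq A] [AddCommMonoid β] {s : Finset A}
    {f g : A → β} {a b : A} (ha : a ∈ s) (hb : b ∈ s) (hab : a ≠ b)
    (h : ∀ x, x ≠ a → x ≠ b → f x = g x) :
    ∑ x ∈ s, f x + (g a + g b) = ∑ x ∈ s, g x + (f a + f b) := by
  have hb' : b ∈ s.erase a := mem_erase.2 ⟨hab.symm, hb⟩
  have hfg : ∑ x ∈ (s.erase a).erase b, f x = ∑ x ∈ (s.erase a).erase b, g x :=
    sum_congr rfl fun x hx => by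
      simp only [mem_erase] at hx
      exact h x hx.2.1 hx.1
  rw [← add_sum_erase s f ha, ← add_sum_erase s g ha, ← add_sum_erase _ f hb',
    ← add_sum_erase _ g hb', hfg]
  abel

lemma inv_succ_lt_log_sub_log {k : ℕ} (hk : 1 ≤ k) :
    1 / ((k : ℝ) + 1) < Real.log (k + 1 : ℕ) - Real.log k := by
  have hk0 : (0 : ℝ) < k := by exact_mod_cast hk
  have h := Real.log_lt_sub_one_of_pos (x := (k : ℝ) / (k + 1)) (by positivity)
    (by rw [ne_eq, div_eq_one_iff_eq (by positivity)]; linarith)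
  rw [Real.log_div (by positivity) (by positivity)] at h
  have he : (k : ℝ) / (k + 1) - 1 = -(1 / (k + 1)) := by field_simp; ring
  push_cast
  linarith

lemma log_sub_log_lt_inv {k : ℕ} (hk : 1 ≤ k) :
    Real.log (k + 1 : ℕ) - Real.log k < 1 / (k : ℝ) := by
  have hk0 : (0 : ℝ) < k := by exact_mod_cast hk
  have h := Real.log_lt_sub_one_of_pos (x := ((k : ℝ) + 1) / k) (by positivity)
    (by rw [ne_eq, div_eq_one_iff_eq (by positivity)]; linarith)
  rw [Real.log_div (by positivity) (by positivity)] at h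
  have he : ((k : ℝ) + 1) / k - 1 = 1 / k := by field_simp; ring
  push_cast
  linarith

/-- If moving one unit from `a` to `b` does not increase the weighted log-sum, then the
multiplicities at `a` and `b` are nearly proportional to the weights. -/
lemma mul_pred_lt_mul_succ_of_exchange {x y : ℝ} (hx : 0 < x) (hy : 0 < y) {k l : ℕ}
    (hk : 1 ≤ k) (hl : 1 ≤ l)
    (h : 2 ≤ k → y * (Real.log (l + 1 : ℕ) - Real.log l)
      ≤ x * (Real.log k - Real.log (k - 1 : ℕ))) :
    y * ((k : ℝ) - 1) < x * ((l : ℝ) + 1) := by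
  obtain ⟨j, rfl⟩ := Nat.exists_eq_add_of_le' hk
  rcases Nat.eq_zero_or_pos j with rfl | hj
  · simp only [zero_add, Nat.cast_one, sub_self, mul_zero]
    positivity
  · have hj0 : (0 : ℝ) < j := by exact_mod_cast hj
    have h1 := mul_lt_mul_of_pos_left (inv_succ_lt_log_sub_log hl) hy
    have h2 := mul_lt_mul_of_pos_left (log_sub_log_lt_inv hj) hx
    have h3 := h (by omega)
    rw [Nat.add_sub_cancel] at h3
    have h4 := h1.trans_le h3 |>.trans h2
    rw [mul_one_div, mul_one_div, div_lt_div_iff₀ (by positivity) hj0] at h4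
    push_cast
    linarith

/-- A maximizer of the weighted log-sum among positive vectors on `S` of fixed total satisfies the
exchange inequality for each pair of distinct indices. -/
lemma mul_pred_lt_mul_succ_of_isMax {A : Type*} [Fintype A] [DecidableEq A] {c : A → ℕ}
    {M : ℕ} {S : Finset A} (hc : ∀ a ∈ S, 0 < c a) {g : A → ℕ}
    (hpos : ∀ a ∈ S, 1 ≤ g a) (hzero : ∀ a ∉ S, g a = 0) (hsum : ∑ a, g a = M)
    (hmax : ∀ n : A → ℕ, (∀ a ∈ S, 1 ≤ n a) → (∀ a ∉ S, n a = 0) → ∑ a, n a = M →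
      ∑ a ∈ S, (c a : ℝ) * Real.log (n a) ≤ ∑ a ∈ S, (c a : ℝ) * Real.log (g a))
    {a b : A} (ha : a ∈ S) (hb : b ∈ S) (hab : a ≠ b) :
    (c b : ℝ) * ((g a : ℝ) - 1) < (c a : ℝ) * ((g b : ℝ) + 1) := by
  refine mul_pred_lt_mul_succ_of_exchange (by exact_mod_cast hc a ha)
    (by exact_mod_cast hc b hb) (hpos a ha) (hpos b hb) fun h2 => ?_
  set n : A → ℕ := Function.update (Function.update g a (g a - 1)) b (g b + 1) with hn
  have hna : n a = g a - 1 := by simp [hn, hab]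
  have hnb : n b = g b + 1 := by simp [hn]
  have hne : ∀ x, x ≠ a → x ≠ b → n x = g x := fun x hxa hxb => by simp [hn, hxa, hxb]
  have hle := hmax n
    (fun x hx => by
      by_cases hxa : x = a
      · subst hxa; omega
      by_cases hxb : x = b
      · subst hxb; omega
      rw [hne x hxa hxb]; exact hpos x hx)
    (fun x hx => by
      rw [hne x (fun h => hx (h ▸ ha)) (fun h => hx (h ▸ hb))]; exact hzero x hx)
    (by
      have := sum_add_pair_comm (mem_univ a) (mem_univ b) hab hne
      omega)
  have hpair := sum_add_pair_comm (f := fun x => (c x : ℝ) * Real.log (n x))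
    (g := fun x => (c x : ℝ) * Real.log (g x)) ha hb hab
    (fun x hxa hxb => by simp only [hne x hxa hxb])
  simp only [hna, hnb] at hpair
  linarith

/-- Summing pairwise exchange inequalities over the second index bounds each multiplicity above. -/
lemma mul_le_of_exchange_sum {A : Type*} [DecidableEq A] {S : Finset A} {x g : A → ℝ}
    (h : ∀ a ∈ S, ∀ b ∈ S, a ≠ b → x b * (g a - 1) < x a * (g b + 1)) {a : A} (ha : a ∈ S) :
    (∑ b ∈ S, x b) * (g a - 1) ≤ x a * (∑ b ∈ S, g b + S.card - 2) := by
  have hs : ∑ b ∈ S.erase a, x b * (g a - 1) ≤ ∑ b ∈ S.erase a, x a * (g b + 1) :=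
    sum_le_sum fun b hb => (h a ha b (mem_of_mem_erase hb) (ne_of_mem_erase hb).symm).le
  have hl := add_sum_erase S (fun b => x b * (g a - 1)) ha
  have hr := add_sum_erase S (fun b => x a * (g b + 1)) ha
  have hl' : ∑ b ∈ S, x b * (g a - 1) = (∑ b ∈ S, x b) * (g a - 1) := (sum_mul ..).symm
  have hr' : ∑ b ∈ S, x a * (g b + 1) = x a * (∑ b ∈ S, g b + S.card) := by
    rw [← mul_sum, sum_add_distrib, sum_const, nsmul_eq_mul, mul_one]
  linarith

/-- Summing pairwise exchange inequalities over the first index bounds each multiplicity below. -/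
lemma le_mul_of_exchange_sum {A : Type*} [DecidableEq A] {S : Finset A} {x g : A → ℝ}
    (h : ∀ a ∈ S, ∀ b ∈ S, a ≠ b → x b * (g a - 1) < x a * (g b + 1)) {b : A} (hb : b ∈ S) :
    x b * (∑ a ∈ S, g a - S.card + 2) ≤ (∑ a ∈ S, x a) * (g b + 1) := by
  have hs : ∑ a ∈ S.erase b, x b * (g a - 1) ≤ ∑ a ∈ S.erase b, x a * (g b + 1) :=
    sum_le_sum fun a ha => (h a (mem_of_mem_erase ha) b hb (ne_of_mem_erase ha)).le
  have hl := add_sum_erase S (fun a => x b * (g a - 1)) hb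
  have hr := add_sum_erase S (fun a => x a * (g b + 1)) hb
  have hl' : ∑ a ∈ S, x b * (g a - 1) = x b * (∑ a ∈ S, g a - S.card) := by
    rw [← mul_sum, sum_sub_distrib, sum_const, nsmul_eq_mul, mul_one]
  have hr' : ∑ a ∈ S, x a * (g b + 1) = (∑ a ∈ S, x a) * (g b + 1) := (sum_mul ..).symm
  linarith

theorem stmt_12 {A : Type*} [Fintype A] [DecidableEq A]
    (c : A → ℕ) (M N r : ℕ) (S : Finset A)
    (hN : N = ∑ a, c a) (hNpos : 0 < N)
    (hS : S = univ.filter fun a => 0 < c a)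
    (hr : r = S.card) (hM : r ≤ M) (hM1 : 1 ≤ M)
    (Feas : (A → ℕ) → Prop)
    (hFeas : ∀ m, Feas m ↔
      ((∀ a ∈ S, 1 ≤ m a) ∧ (∀ a ∉ S, m a = 0) ∧ ∑ a, m a = M))
    (Φ : (A → ℕ) → ℝ)
    (hΦ : ∀ m, Φ m = ∑ a ∈ S, (c a : ℝ) * Real.log (m a))
    (L U : A → ℤ)
    (hL : ∀ a ∈ S, L a =
      max 1 ⌈(M : ℝ) * (c a : ℝ) / N - (c a : ℝ) / N * ((r : ℝ) - 2) - 1⌉)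
    (hU : ∀ a ∈ S, U a =
      ⌊(M : ℝ) * (c a : ℝ) / N + (c a : ℝ) / N * ((r : ℝ) - 2) + 1⌋)
    (BoxFeas : (A → ℕ) → Prop)
    (hBoxFeas : ∀ m, BoxFeas m ↔
      (Feas m ∧ ∀ a ∈ S, L a ≤ (m a : ℤ) ∧ (m a : ℤ) ≤ U a))
    (mhat : A → ℕ) (hmhat : BoxFeas mhat)
    (hmax : ∀ n, BoxFeas n → Φ n ≤ Φ mhat) :
    ∀ n, Feas n → Φ n ≤ Φ mhat := by
  have hfin : {m | Feas m}.Finite := by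
    refine (Set.finite_Icc (0 : A → ℕ) fun _ => M).subset fun m hm => ⟨zero_le, fun a => ?_⟩
    rw [← ((hFeas m).1 hm).2.2]
    exact single_le_sum (fun _ _ => Nat.zero_le _) (mem_univ a)
  obtain ⟨g, hg, hgmax⟩ := Set.exists_max_image {m | Feas m} Φ hfin
    ⟨mhat, ((hBoxFeas mhat).1 hmhat).1⟩
  obtain ⟨hpos, hzero, hsum⟩ := (hFeas g).1 hg
  have hc : ∀ a ∈ S, 0 < c a := fun a ha => by simpa [hS] using ha
  have hex : ∀ a ∈ S, ∀ b ∈ S, a ≠ b →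
      (c b : ℝ) * ((g a : ℝ) - 1) < (c a : ℝ) * ((g b : ℝ) + 1) := fun a ha b hb hab =>
    mul_pred_lt_mul_succ_of_isMax hc hpos hzero hsum
      (fun n h1 h2 h3 => by
        rw [← hΦ, ← hΦ]
        exact hgmax n ((hFeas n).2 ⟨h1, h2, h3⟩)) ha hb hab
  have hcS : ∑ a ∈ S, (c a : ℝ) = N := by
    rw [hN, Nat.cast_sum]
    refine sum_subset (subset_univ S) fun a _ ha => ?_
    simpa [hS] using ha
  have hgS : ∑ a ∈ S, (g a : ℝ) = M := by
    rw [← hsum, Nat.cast_sum]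
    exact sum_subset (subset_univ S) fun a _ ha => by rw [hzero a ha, Nat.cast_zero]
  have hN0 : (0 : ℝ) < N := by exact_mod_cast hNpos
  have hbox : BoxFeas g := by
    refine (hBoxFeas g).2 ⟨hg, fun a ha => ⟨?_, ?_⟩⟩
    · have h := le_mul_of_exchange_sum (x := fun a => (c a : ℝ)) (g := fun a => (g a : ℝ)) hex ha
      simp only [hcS, hgS, ← hr] at h
      rw [hL a ha]
      refine max_le (by exact_mod_cast hpos a ha) (Int.ceil_le.2 ?_)
      have h' : (c a : ℝ) * (M - r + 2) / N ≤ g a + 1 := by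
        rw [div_le_iff₀ hN0]
        linarith
      have he : (M : ℝ) * (c a : ℝ) / N - (c a : ℝ) / N * ((r : ℝ) - 2) - 1
          = (c a : ℝ) * (M - r + 2) / N - 1 := by ring
      rw [he, Int.cast_natCast]
      linarith
    · have h := mul_le_of_exchange_sum (x := fun a => (c a : ℝ)) (g := fun a => (g a : ℝ)) hex ha
      simp only [hcS, hgS, ← hr] at h
      rw [hU a ha]
      refine Int.le_floor.2 ?_
      have h' : (g a : ℝ) - 1 ≤ (c a : ℝ) * (M + r - 2) / N := by
        rw [le_div_iff₀ hN0]
        linarith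
      have he : (M : ℝ) * (c a : ℝ) / N + (c a : ℝ) / N * ((r : ℝ) - 2) + 1
          = (c a : ℝ) * (M + r - 2) / N + 1 := by ring
      rw [he, Int.cast_natCast]
      linarith
  exact fun n hn => (hgmax n hn).trans (hmax g hbox)
end

section
/- Let U : A → ℕ satisfy U_a ≥ 1 for a ∈ S and U_a = 0 off S, with ∑_{a∈S} U_a ≥ M, and set D = ∑_{a∈S} U_a − M. Let F be a subset of {(a, j) : a ∈ S, 2 ≤ j ≤ U_a} of cardinality D minimizing ∑_{(a,j)∈F} c_a·log(j/(j−1)) among all such subsets of cardinality D, and define m by m_a = U_a − |{j : (a, j) ∈ F}| for a ∈ S and m_a = 0 off S. Then m is support-feasible and maximizes Φ over all support-feasible vectors n with n_a ≤ U_a for every a ∈ S; i.e., selecting the D cheapest decrement tickets from the envelope U yields the envelope-constrained optimum. -/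
open Finset

/-- The unit decrement costs `log (j / (j - 1))` telescope over an interval. -/
lemma sum_Ioc_log_div_pred {l u : ℕ} (hl : 1 ≤ l) (hlu : l ≤ u) :
    ∑ j ∈ Ioc l u, Real.log ((j : ℝ) / ((j : ℝ) - 1)) = Real.log u - Real.log l := by
  induction u, hlu using Nat.le_induction with
  | base => simp
  | succ u hu ih =>
    have hu0 : (u : ℝ) ≠ 0 := by norm_cast; omega
    rw [Finset.sum_Ioc_succ_top hu, ih, Nat.cast_add_one, add_sub_cancel_right,
      Real.log_div (by positivity) hu0]
    ring

/-- Among the sets of `k` decrements below `u`, the topmost `k` have the least total cost. -/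
lemma log_sub_log_sub_card_le_sum {u : ℕ} (hu : 1 ≤ u) {T : Finset ℕ} (hT : T ⊆ Ioc 1 u) :
    Real.log u - Real.log ((u - T.card : ℕ) : ℝ) ≤
      ∑ j ∈ T, Real.log ((j : ℝ) / ((j : ℝ) - 1)) := by
  induction u, hu using Nat.le_induction generalizing T with
  | base => simp_all
  | succ u hu ih =>
    have hu0 : (0 : ℝ) < u := by exact_mod_cast hu
    by_cases hmem : u + 1 ∈ T
    · have hsub : T.erase (u + 1) ⊆ Ioc 1 u := fun j hj => by
        have h1 := mem_erase.mp hj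
        have h2 := mem_Ioc.mp (hT h1.2)
        exact mem_Ioc.mpr ⟨h2.1, by omega⟩
      have h := ih hsub
      have hcard : u - (T.erase (u + 1)).card = u + 1 - T.card := by
        have := card_pos.mpr ⟨_, hmem⟩
        rw [card_erase_of_mem hmem]
        omega
      rw [← add_sum_erase T _ hmem, Nat.cast_add_one, add_sub_cancel_right,
        Real.log_div (by positivity) hu0.ne']
      rw [hcard] at h
      linarith
    · have hsub : T ⊆ Ioc 1 u := fun j hj => by
        have h2 := mem_Ioc.mp (hT hj)
        have : j ≠ u + 1 := fun h => hmem (h ▸ hj)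
        exact mem_Ioc.mpr ⟨h2.1, by omega⟩
      have hcard : T.card ≤ u - 1 := by simpa using card_le_card hsub
      have h := ih hsub
      obtain ⟨v, hv⟩ : ∃ v, u = v + T.card := ⟨u - T.card, by omega⟩
      have hv0 : (0 : ℝ) < v := by
        have : 0 < v := by omega
        exact_mod_cast this
      have e1 : u - T.card = v := by omega
      have e2 : u + 1 - T.card = v + 1 := by omega
      have huv : (v : ℝ) ≤ u := by
        have : v ≤ u := by omega
        exact_mod_cast this
      rw [e1] at h
      rw [e2]
      push_cast
      have key : Real.log (((u : ℝ) + 1) * v) ≤ Real.log ((u : ℝ) * (v + 1)) :=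
        Real.log_le_log (by positivity) (by linarith)
      rw [Real.log_mul (by positivity) hv0.ne', Real.log_mul hu0.ne' (by positivity)] at key
      linarith

theorem stmt_14 {A : Type*} [Fintype A] [DecidableEq A]
    (c : A → ℕ) (M N r : ℕ) (S : Finset A)
    (hN : N = ∑ a, c a) (hNpos : 0 < N)
    (hS : S = univ.filter fun a => 0 < c a)
    (hr : r = S.card) (hM : r ≤ M) (hM1 : 1 ≤ M)
    (Feas : (A → ℕ) → Prop)
    (hFeas : ∀ m, Feas m ↔
      ((∀ a ∈ S, 1 ≤ m a) ∧ (∀ a ∉ S, m a = 0) ∧ ∑ a, m a = M))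
    (Φ : (A → ℕ) → ℝ)
    (hΦ : ∀ m, Φ m = ∑ a ∈ S, (c a : ℝ) * Real.log (m a))
    (U : A → ℕ) (hU1 : ∀ a ∈ S, 1 ≤ U a) (hU0 : ∀ a ∉ S, U a = 0)
    (hUsum : M ≤ ∑ a ∈ S, U a)
    (D : ℕ) (hD : D = (∑ a ∈ S, U a) - M)
    (F : Finset (A × ℕ))
    (hFsub : ∀ p ∈ F, p.1 ∈ S ∧ 2 ≤ p.2 ∧ p.2 ≤ U p.1)
    (hFcard : F.card = D)
    (hFmin : ∀ G : Finset (A × ℕ),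
      (∀ p ∈ G, p.1 ∈ S ∧ 2 ≤ p.2 ∧ p.2 ≤ U p.1) → G.card = D →
      ∑ p ∈ F, (c p.1 : ℝ) * Real.log ((p.2 : ℝ) / ((p.2 : ℝ) - 1)) ≤
      ∑ p ∈ G, (c p.1 : ℝ) * Real.log ((p.2 : ℝ) / ((p.2 : ℝ) - 1)))
    (m : A → ℕ)
    (hm : ∀ a, m a = if a ∈ S then U a - (F.filter fun p => p.1 = a).card else 0) :
    Feas m ∧ ∀ n, Feas n → (∀ a ∈ S, n a ≤ U a) → Φ n ≤ Φ m := by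
  have hmaps : ∀ p ∈ F, p.1 ∈ S := fun p hp => (hFsub p hp).1
  let T : A → Finset ℕ := fun a => (F.filter fun p => p.1 = a).image Prod.snd
  have hinj (a : A) : Set.InjOn Prod.snd (F.filter fun p => p.1 = a : Set (A × ℕ)) := by
    intro p hp q hq h
    simp only [coe_filter, Set.mem_ofPred_eq] at hp hq
    exact Prod.ext (hp.2.trans hq.2.symm) h
  have hTcard (a : A) : (T a).card = (F.filter fun p => p.1 = a).card :=
    card_image_of_injOn (hinj a)
  have hTsub (a : A) : T a ⊆ Ioc 1 (U a) := by
    intro j hj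
    obtain ⟨p, hp, rfl⟩ := mem_image.mp hj
    obtain ⟨hpF, rfl⟩ := mem_filter.mp hp
    have := hFsub p hpF
    exact mem_Ioc.mpr ⟨by omega, this.2.2⟩
  have hTle (a : A) : (T a).card ≤ U a - 1 := by simpa using card_le_card (hTsub a)
  have hmS (a : A) (ha : a ∈ S) : m a = U a - (T a).card := by
    rw [hm, if_pos ha, hTcard]
  have hsumS (n : A → ℕ) (hn : ∀ a ∉ S, n a = 0) : ∑ a, n a = ∑ a ∈ S, n a :=
    (sum_subset (subset_univ S) fun a _ ha => hn a ha).symm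
  have hm0 : ∀ a ∉ S, m a = 0 := fun a ha => by rw [hm, if_neg ha]
  refine ⟨(hFeas m).mpr ⟨fun a ha => ?_, hm0, ?_⟩, fun n hn hnU => ?_⟩
  · have := hTle a
    have := hU1 a ha
    rw [hmS a ha]
    omega
  · have hcard : ∑ a ∈ S, (T a).card = D := by
      rw [← hFcard, card_eq_sum_card_fiberwise hmaps]
      exact sum_congr rfl fun a _ => hTcard a
    have hadd : ∑ a ∈ S, m a + ∑ a ∈ S, (T a).card = ∑ a ∈ S, U a := by
      rw [← sum_add_distrib]
      refine sum_congr rfl fun a ha => ?_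
      have := hTle a
      rw [hmS a ha]
      omega
    rw [hsumS m hm0]
    omega
  · obtain ⟨hn1, hn0, hnM⟩ := (hFeas n).mp hn
    let G : Finset (A × ℕ) :=
      (S.sigma fun a => Ioc (n a) (U a)).map (Equiv.sigmaEquivProd A ℕ).toEmbedding
    have hGsub : ∀ p ∈ G, p.1 ∈ S ∧ 2 ≤ p.2 ∧ p.2 ≤ U p.1 := by
      intro p hp
      obtain ⟨q, hq, rfl⟩ := mem_map.mp hp
      obtain ⟨hqS, hqI⟩ := mem_sigma.mp hq
      have hlt := (mem_Ioc.mp hqI).1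
      have := hn1 _ hqS
      exact ⟨hqS, show 2 ≤ q.2 by omega, (mem_Ioc.mp hqI).2⟩
    have hGcard : G.card = D := by
      have hadd : ∑ a ∈ S, (U a - n a) + ∑ a ∈ S, n a = ∑ a ∈ S, U a := by
        rw [← sum_add_distrib]
        exact sum_congr rfl fun a ha => Nat.sub_add_cancel (hnU a ha)
      rw [← hsumS n hn0, hnM] at hadd
      simp only [G, card_map, card_sigma, Nat.card_Ioc]
      omega
    have hG : ∑ p ∈ G, (c p.1 : ℝ) * Real.log ((p.2 : ℝ) / ((p.2 : ℝ) - 1)) = Φ U - Φ n := by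
      rw [hΦ, hΦ, ← sum_sub_distrib, sum_map, sum_sigma]
      refine sum_congr rfl fun a ha => ?_
      rw [← mul_sub, ← sum_Ioc_log_div_pred (hn1 a ha) (hnU a ha), mul_sum]
      rfl
    have hF : Φ U - Φ m ≤ ∑ p ∈ F, (c p.1 : ℝ) * Real.log ((p.2 : ℝ) / ((p.2 : ℝ) - 1)) := by
      rw [hΦ, hΦ, ← sum_sub_distrib, ← sum_fiberwise_of_maps_to hmaps]
      refine sum_le_sum fun a ha => ?_
      have hfib : ∑ p ∈ F with p.1 = a, (c p.1 : ℝ) * Real.log ((p.2 : ℝ) / ((p.2 : ℝ) - 1)) =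
          (c a : ℝ) * ∑ j ∈ T a, Real.log ((j : ℝ) / ((j : ℝ) - 1)) := by
        rw [sum_image (hinj a), mul_sum]
        exact sum_congr rfl fun p hp => by rw [(mem_filter.mp hp).2]
      rw [hfib, ← mul_sub, hmS a ha]
      exact mul_le_mul_of_nonneg_left (log_sub_log_sub_card_le_sum (hU1 a ha) (hTsub a))
        (Nat.cast_nonneg _)
    have := hFmin G hGsub hGcard
    linarith
end

section
/- For the alphabet of nine symbols with counts c = (22, 4, 4, 4, 4, 4, 4, 4, 4) (so N = 54) and target M = 16, the vector m = (7, 2, 1, 1, 1, 1, 1, 1, 1) is support-feasible but does not maximize Φ: the vector m* = (8, 1, 1, 1, 1, 1, 1, 1, 1) is support-feasible and Φ(m*) − Φ(m) = 22·log(8/7) − 4·log(2) > 0. In particular, there is a support-feasible Φ-maximizer whose first coordinate exceeds the ceiling envelope ⌈M·c₁/N⌉ = 7, so Collet's ceiling-initialized decrement-only normalization is not KL-optimal on this instance. -/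
open Finset

theorem log_natCast_le_mul_log_two_of_pow_le {x p q : ℕ} (hx : 0 < x) (h : x ^ p ≤ 2 ^ q) :
    (p : ℝ) * Real.log x ≤ q * Real.log 2 := by
  rw [← Real.log_pow, ← Real.log_pow]
  exact Real.log_le_log (by positivity) (by exact_mod_cast h)

theorem log_natCast_le_sub_one_mul_log_two {x : ℕ} (hx : 0 < x) :
    Real.log x ≤ ((x : ℝ) - 1) * Real.log 2 := by
  obtain ⟨y, rfl⟩ := Nat.exists_eq_add_of_lt hx
  have h := log_natCast_le_mul_log_two_of_pow_le (x := 0 + y + 1) (p := 1) (q := y) hx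
    (by rw [pow_one, zero_add]; exact Nat.lt_two_pow_self)
  simpa using h

theorem log_eight_div_seven_sub_log_two_pos : 0 < 22 * Real.log ((8 : ℝ) / 7) - 4 * Real.log 2 := by
  have h : Real.log ((2 : ℝ) ^ 4) < Real.log (((8 : ℝ) / 7) ^ 22) :=
    Real.log_lt_log (by norm_num) (by norm_num)
  rw [Real.log_pow, Real.log_pow] at h
  push_cast at h
  linarith

theorem log_eight_eq : Real.log 8 = 3 * Real.log 2 := by
  rw [show (8 : ℝ) = 2 ^ 3 by norm_num, Real.log_pow]
  norm_num

theorem stmt_16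
    (c : Fin 9 → ℕ) (hc : c = ![22, 4, 4, 4, 4, 4, 4, 4, 4])
    (N : ℕ) (hN : N = ∑ a, c a)
    (M : ℕ) (hM : M = 16)
    (S : Finset (Fin 9)) (hS : S = univ.filter fun a => 0 < c a)
    (Feas : (Fin 9 → ℕ) → Prop)
    (hFeas : ∀ m, Feas m ↔
      ((∀ a ∈ S, 1 ≤ m a) ∧ (∀ a ∉ S, m a = 0) ∧ ∑ a, m a = M))
    (Φ : (Fin 9 → ℕ) → ℝ)
    (hΦ : ∀ m, Φ m = ∑ a ∈ S, (c a : ℝ) * Real.log (m a)) :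
    N = 54 ∧
    Feas ![7, 2, 1, 1, 1, 1, 1, 1, 1] ∧
    Feas ![8, 1, 1, 1, 1, 1, 1, 1, 1] ∧
    Φ ![8, 1, 1, 1, 1, 1, 1, 1, 1] - Φ ![7, 2, 1, 1, 1, 1, 1, 1, 1] =
      22 * Real.log (8 / 7) - 4 * Real.log 2 ∧
    0 < 22 * Real.log ((8 : ℝ) / 7) - 4 * Real.log 2 ∧
    ¬ (∀ n, Feas n → Φ n ≤ Φ ![7, 2, 1, 1, 1, 1, 1, 1, 1]) ∧
    ⌈(M : ℝ) * (c 0 : ℝ) / (N : ℝ)⌉ = 7 ∧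
    (∃ n, Feas n ∧ (∀ k, Feas k → Φ k ≤ Φ n) ∧ 7 < n 0) := by
  have hSu : S = univ := by
    subst hS hc
    decide
  have hN54 : N = 54 := by
    subst hN hc
    decide
  have hFeas' : ∀ m, Feas m ↔ (∀ a, 1 ≤ m a) ∧ ∑ a, m a = 16 := by
    intro m
    simp [hFeas, hSu, hM]
  have hΦ' : ∀ m, Φ m = 22 * Real.log (m 0) + 4 * (Real.log (m 1) + Real.log (m 2) +
      Real.log (m 3) + Real.log (m 4) + Real.log (m 5) + Real.log (m 6) + Real.log (m 7) +
      Real.log (m 8)) := by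
    intro m
    rw [hΦ, hSu, hc]
    simp [Fin.sum_univ_succ]
    ring_nf
  have hm : Feas ![7, 2, 1, 1, 1, 1, 1, 1, 1] := (hFeas' _).2 (by decide)
  have hm' : Feas ![8, 1, 1, 1, 1, 1, 1, 1, 1] := (hFeas' _).2 (by decide)
  have hopt : Φ ![8, 1, 1, 1, 1, 1, 1, 1, 1] = 22 * Real.log 8 := by
    rw [hΦ']
    simp
  have hdiff : Φ ![8, 1, 1, 1, 1, 1, 1, 1, 1] - Φ ![7, 2, 1, 1, 1, 1, 1, 1, 1] =
      22 * Real.log (8 / 7) - 4 * Real.log 2 := by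
    rw [hopt, hΦ', Real.log_div (by norm_num) (by norm_num)]
    simp
    ring
  have hpos := log_eight_div_seven_sub_log_two_pos
  refine ⟨hN54, hm, hm', hdiff, hpos, fun h => ?_, ?_, _, hm', fun k hk => ?_, by decide⟩
  · linarith [h _ hm']
  · rw [hM, hN54, hc, Int.ceil_eq_iff]
    norm_num
  · obtain ⟨hone, hsum⟩ := (hFeas' k).1 hk
    have hsum' : k 0 + k 1 + k 2 + k 3 + k 4 + k 5 + k 6 + k 7 + k 8 = 16 := by
      rw [← hsum]
      simp only [Fin.sum_univ_succ, Fin.sum_univ_zero, add_zero, ← add_assoc]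
      rfl
    have hle : k 0 ≤ 8 := by
      linarith [hone 1, hone 2, hone 3, hone 4, hone 5, hone 6, hone 7, hone 8]
    have hpow : k 0 ^ 11 ≤ 2 ^ (17 + 2 * k 0) := by
      have h0 := hone 0
      generalize k 0 = x at *
      interval_cases x <;> norm_num
    have hfirst := log_natCast_le_mul_log_two_of_pow_le (hone 0) hpow
    have hrest := fun a => log_natCast_le_sub_one_mul_log_two (hone a)
    have hsumR : (k 0 : ℝ) + k 1 + k 2 + k 3 + k 4 + k 5 + k 6 + k 7 + k 8 = 16 := by
      exact_mod_cast hsum'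
    have hmul := congrArg (· * Real.log 2) hsumR
    push_cast at hfirst
    rw [hopt, hΦ', log_eight_eq]
    linarith [hrest 1, hrest 2, hrest 3, hrest 4, hrest 5, hrest 6, hrest 7, hrest 8]
end
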